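/- arXiv:2603.26315 — 2 statements merged into one kernel-verified Lean document; each statement's English description precedes it below -/
import Mathlib

section
/- Let p be a prime, r ≥ 1 an integer, and G a finite abelian group of order n with p not dividing n. For each divisor d of n, let n_d be the number of elements of order d in G and let o_d be the multiplicative order of p modulo d (the order of the unit p in (Z/dZ)ˣ; p is a unit modulo d since p does not divide n). Then o_d divides n_d for every divisor d of n, and for every family (h_d)_{d ∣ n} of polynomials with h_d ∈ (Z_{p^r})[X] basic irreducible of degree o_d, there is a ring isomorphism between the group algebra Z_{p^r}G and the product ∏_{d ∣ n} ((Z_{p^r})[X] / ⟨h_d⟩)^{n_d / o_d}, i.e., the product over all divisors d of n of n_d/o_d copies of the quotient ring (Z_{p^r})[X] / ⟨h_d⟩. -/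
theorem aux_lift (p r : ℕ) [Fact p.Prime] (hr : 1 ≤ r)
    (G : Type*) [CommGroup G] [Fintype G] (hG : ¬ p ∣ Fintype.card G)
    (B C : Type*) [CommRing B] [CommRing C] [Algebra (ZMod (p ^ r)) B] [Finite B]
    (π : B →+* C) (hπ : Function.Surjective π) (hker : ∀ b, π b = 0 → (p : B) ∣ b)
    (e : MonoidAlgebra (ZMod p) G ≃+* C)
    (hcard : Nat.card B = (p ^ r) ^ Fintype.card G) :
    Nonempty (MonoidAlgebra (ZMod (p ^ r)) G ≃+* B) := by
  have hp : p.Prime := Fact.out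
  have hpB : (p : B) ^ r = 0 := by
    have : ((p ^ r : ℕ) : ZMod (p ^ r)) = 0 := ZMod.natCast_self _
    have := congrArg (algebraMap (ZMod (p ^ r)) B) this
    rwa [map_natCast, map_zero, Nat.cast_pow] at this
  have hcop : (Nat.card G).Coprime (p ^ (r - 1)) := by
    rw [Nat.card_eq_fintype_card]
    exact Nat.Coprime.pow_right _ ((hp.coprime_iff_not_dvd.2 hG).symm)
  -- multiplicative Teichmueller section
  have key : ∀ x y : B, π x = π y → x ^ p ^ (r - 1) = y ^ p ^ (r - 1) := by
    intro x y hxy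
    have h1 : (p : B) ∣ x - y := hker _ (by simp [hxy])
    have h2 := dvd_sub_pow_of_dvd_sub h1 (r - 1)
    rw [Nat.sub_add_cancel hr, hpB, zero_dvd_iff, sub_eq_zero] at h2
    exact h2
  choose s hs using hπ
  let T : C →* B :=
    { toFun := fun c => (s c) ^ p ^ (r - 1)
      map_one' := by
        rw [key (s 1) 1 (by simp [hs])]; simp
      map_mul' := fun x y => by
        rw [key (s (x * y)) (s x * s y) (by simp [hs]), mul_pow] }
  have hT : ∀ c, π (T c) = c ^ p ^ (r - 1) := fun c => by simp [T, hs]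
  let q : G ≃ G := powCoprime hcop
  let qm : G ≃* G := MulEquiv.mk' q (fun x y => by simp [q, powCoprime, mul_pow])
  let F : G →* B := (T.comp ((e : MonoidAlgebra (ZMod p) G →* C).comp
    (MonoidAlgebra.of (ZMod p) G))).comp (qm.symm : G →* G)
  have hF : ∀ g, π (F g) = e (MonoidAlgebra.of (ZMod p) G g) := by
    intro g
    have : g = (qm.symm g) ^ p ^ (r - 1) := (qm.apply_symm_apply g).symm
    conv_rhs => rw [this, map_pow, map_pow]
    simp only [F, MonoidHom.comp_apply, hT]
    rfl
  let ψ : MonoidAlgebra (ZMod (p ^ r)) G →ₐ[ZMod (p ^ r)] B :=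
    MonoidAlgebra.lift (ZMod (p ^ r)) B G F
  let ρ : MonoidAlgebra (ZMod (p ^ r)) G →+* MonoidAlgebra (ZMod p) G :=
    MonoidAlgebra.mapRingHom G
      (ZMod.castHom (dvd_pow_self p (Nat.one_le_iff_ne_zero.mp hr)) (ZMod p))
  have hρ : Function.Surjective ρ := by
    intro y
    induction y using MonoidAlgebra.induction_linear with
    | zero => exact ⟨0, map_zero _⟩
    | add f g hf hg =>
      obtain ⟨a, rfl⟩ := hf
      obtain ⟨b, rfl⟩ := hg
      exact ⟨a + b, map_add _ _ _⟩
    | single g c =>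
      obtain ⟨c', rfl⟩ := ZMod.ringHom_surjective
        (ZMod.castHom (dvd_pow_self p (Nat.one_le_iff_ne_zero.mp hr)) (ZMod p)) c
      exact ⟨MonoidAlgebra.single g c', by simp [ρ]⟩
  have hcomm : π.comp (ψ : MonoidAlgebra (ZMod (p ^ r)) G →+* B) = (e : _ →+* C).comp ρ := by
    apply MonoidAlgebra.ringHom_ext'
    · exact RingHom.ext_zmod _ _
    · ext g
      have := hF g
      simp [ψ, ρ] at this ⊢
      rw [this, ZMod.cast_one (dvd_pow_self p (Nat.one_le_iff_ne_zero.mp hr))]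
  have h1 : ∀ b, ∃ a b', b = ψ a + p * b' := by
    intro b
    obtain ⟨a, ha⟩ := hρ (e.symm (π b))
    have h3 : π (ψ a) = π b := by
      have := RingHom.congr_fun hcomm a
      simp [ha] at this
      exact this
    obtain ⟨b', hb'⟩ := hker (b - ψ a) (by simp [h3])
    exact ⟨a, b', by rw [← hb']; ring⟩
  have h2 : ∀ k : ℕ, ∀ b, ∃ a b', b = ψ a + p ^ k * b' := by
    intro k
    induction k with
    | zero => exact fun b => ⟨0, b, by simp⟩
    | succ k ih =>
      intro b
      obtain ⟨a, b', rfl⟩ := ih b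
      obtain ⟨a', b'', rfl⟩ := h1 b'
      exact ⟨a + p ^ k * a', b'', by simp; ring⟩
  have hsurj : Function.Surjective ψ := by
    intro b
    obtain ⟨a, b', h⟩ := h2 r b
    exact ⟨a, by rw [h, hpB]; simp⟩
  have : NeZero (p ^ r) := ⟨pow_ne_zero _ hp.ne_zero⟩
  have eqv : MonoidAlgebra (ZMod (p ^ r)) G ≃ (G → ZMod (p ^ r)) :=
    (MonoidAlgebra.coeffEquiv).trans Finsupp.equivFunOnFinite
  have : Finite (MonoidAlgebra (ZMod (p ^ r)) G) := Finite.of_equiv _ eqv.symm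
  have hc : Nat.card (MonoidAlgebra (ZMod (p ^ r)) G) = Nat.card B := by
    rw [hcard, Nat.card_congr eqv, Nat.card_fun, Nat.card_zmod, Nat.card_eq_fintype_card]
  have hbij : Function.Bijective ψ := 
    (Nat.bijective_iff_surjective_and_card ψ).2 ⟨hsurj, hc⟩
  exact ⟨RingEquiv.ofBijective ψ hbij⟩

theorem aux_pos (p d : ℕ) (h : p.Coprime d) (hd : d ≠ 0) : 0 < orderOf (p : ZMod d) := by
  have : NeZero d := ⟨hd⟩
  rw [← ZMod.coe_unitOfCoprime p h, orderOf_units]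
  exact orderOf_pos _

theorem aux_dvd (p : ℕ) (G : Type*) [CommGroup G] [Fintype G] (d : ℕ) (hd : d ≠ 0)
    (h : p.Coprime d) : orderOf (p : ZMod d) ∣ Nat.card {x : G // orderOf x = d} := by
  classical
  have : NeZero d := ⟨hd⟩
  have h1 : orderOf (p : ZMod d) ∣ d.totient := by
    rw [← ZMod.coe_unitOfCoprime p h, orderOf_units, ← ZMod.card_units_eq_totient]
    exact orderOf_dvd_card
  refine h1.trans ?_
  rw [Nat.card_eq_fintype_card, Fintype.card_subtype]
  rw [Finset.card_eq_sum_card_image (fun x : G => Subgroup.zpowers x)]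
  refine Finset.dvd_sum ?_
  intro H hH
  obtain ⟨x, hx, rfl⟩ := Finset.mem_image.1 hH
  simp only [Finset.mem_filter, Finset.mem_univ, true_and] at hx
  have h2 : (Finset.univ.filter (fun y : Subgroup.zpowers x => orderOf y = d)).card = d.totient :=
    IsCyclic.card_orderOf_eq_totient (by simp [Fintype.card_zpowers, hx])
  rw [← h2]
  apply dvd_of_eq
  refine Finset.card_bij (fun y _ => (y : G)) ?_ ?_ ?_
  · intro y hy
    simp only [Finset.mem_filter, Finset.mem_univ, true_and] at hy ⊢
    have h3 : orderOf (y : G) = d := by rw [Subgroup.orderOf_coe, hy]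
    refine ⟨h3, ?_⟩
    apply Subgroup.eq_of_le_of_card_ge
    · simp
    · rw [Nat.card_zpowers, Nat.card_zpowers, h3, hx]
  · intro a _ b _ hab
    exact Subtype.ext hab
  · intro b hb
    simp only [Finset.mem_filter, Finset.mem_univ, true_and] at hb
    refine ⟨⟨b, hb.2 ▸ Subgroup.mem_zpowers b⟩, ?_, rfl⟩
    simp only [Finset.mem_filter, Finset.mem_univ, true_and]
    rw [← Subgroup.orderOf_coe]
    exact hb.1

theorem aux_red (f : ℕ) (hf : 0 < f) {K : Type*} [Fintype K] (c : K → ℕ) :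
    ∑ i, (if c i ∣ f then c i else 0) =
      ∑ d ∈ f.divisors, Nat.card {i // c i = d} * d := by
  classical
  rw [← Finset.sum_filter]
  rw [← Finset.sum_fiberwise_of_maps_to (s := Finset.univ.filter (fun i => c i ∣ f))
    (t := f.divisors) (g := c) (by intro i hi; simp at hi ⊢; exact ⟨hi, hf.ne'⟩)]
  refine Finset.sum_congr rfl fun d hd => ?_
  have hd' := Nat.dvd_of_mem_divisors hd
  rw [Nat.card_eq_fintype_card, Fintype.card_subtype, Finset.filter_filter,
    Finset.sum_congr rfl (g := fun _ => d) (by intro x hx; simp at hx; exact hx.2)]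
  rw [Finset.sum_const, smul_eq_mul]
  congr 2
  ext i
  simp
  rintro rfl
  exact hd'

/-- counting lemma -/
theorem aux_count {I J : Type*} [Fintype I] [Fintype J] (a : I → ℕ) (b : J → ℕ)
    (ha : ∀ i, 0 < a i) (hb : ∀ j, 0 < b j)
    (h : ∀ f, 0 < f → ∑ i, (if a i ∣ f then a i else 0) = ∑ j, (if b j ∣ f then b j else 0)) :
    ∃ e : I ≃ J, ∀ i, b (e i) = a i := by
  classical
  have key : ∀ f, Nat.card {i // a i = f} = Nat.card {j // b j = f} := by
    intro f
    induction f using Nat.strong_induction_on with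
    | _ f ih =>
      rcases Nat.eq_zero_or_pos f with rfl | hf
      · have : IsEmpty {i // a i = 0} := ⟨fun x => (ha x.1).ne' x.2⟩
        have : IsEmpty {j // b j = 0} := ⟨fun x => (hb x.1).ne' x.2⟩
        simp
      have hh := h f hf
      rw [aux_red f hf a, aux_red f hf b, ← Nat.insert_self_properDivisors hf.ne', 
        Finset.sum_insert (by simp), Finset.sum_insert (by simp)] at hh
      rw [Finset.sum_congr rfl (g := fun d => Nat.card {j // b j = d} * d)
        (by intro d hd; rw [ih d (Nat.mem_properDivisors.1 hd).2])] at hh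
      exact Nat.eq_of_mul_eq_mul_right hf (Nat.add_right_cancel hh)
  let E : ∀ f, {i // a i = f} ≃ {j // b j = f} := fun f =>
    Fintype.equivOfCardEq (by simpa only [Nat.card_eq_fintype_card] using key f)
  let e : I ≃ J := (Equiv.sigmaFiberEquiv a).symm.trans
    ((Equiv.sigmaCongrRight fun f => E f).trans (Equiv.sigmaFiberEquiv b))
  refine ⟨e, fun i => ?_⟩
  exact ((E (a i)) ⟨i, rfl⟩).2


theorem aux_frob (p f : ℕ) [Fact p.Prime] (K : Type*) [Field K] [Algebra (ZMod p) K] (a : K) :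
    (FiniteField.frobeniusAlgHom (ZMod p) K ^ f) a = a ^ p ^ f := by
  induction f with
  | zero => simp
  | succ f ih =>
    rw [pow_succ', AlgHom.mul_apply, ih, FiniteField.frobeniusAlgHom_apply, ZMod.card, ← pow_mul,
      pow_succ]

theorem aux_field (p f : ℕ) [Fact p.Prime] (K L : Type*) [Field K] [Algebra (ZMod p) K]
    [Finite K] [Field L] [Algebra (ZMod p) L] [IsAlgClosed L] :
    Nat.card {ψ : K →ₐ[ZMod p] L // ∀ a, ψ a ^ p ^ f = ψ a} =
      (if Module.finrank (ZMod p) K ∣ f then Module.finrank (ZMod p) K else 0) := by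
  classical
  have hfr : (∀ a : K, a ^ p ^ f = a) ↔ Module.finrank (ZMod p) K ∣ f := by
    rw [← FiniteField.orderOf_frobeniusAlgHom (ZMod p) K, orderOf_dvd_iff_pow_eq_one]
    have : ∀ a : K, (FiniteField.frobeniusAlgHom (ZMod p) K ^ f) a = a ^ p ^ f := by
      exact aux_frob p f K
    rw [AlgHom.ext_iff]
    simp only [this]
    rfl
  have hfr2 : ∀ ψ : K →ₐ[ZMod p] L, (∀ a, ψ a ^ p ^ f = ψ a) ↔ Module.finrank (ZMod p) K ∣ f := by
    intro ψ
    rw [← hfr]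
    refine forall_congr' fun a => ?_
    rw [← map_pow]
    exact ψ.toRingHom.injective.eq_iff
  simp only [hfr2]
  split_ifs with h
  · simp only [h]
    rw [Nat.card_congr (Equiv.subtypeUnivEquiv (fun _ => trivial)), Nat.card_eq_fintype_card]
    exact AlgHom.card (ZMod p) K L
  · simp [h]

theorem aux_homs (p f : ℕ) [Fact p.Prime] (A L : Type*) [CommRing A] [Algebra (ZMod p) A]
    [Finite A] [Field L] [Algebra (ZMod p) L] [IsAlgClosed L] [Fintype (MaximalSpectrum A)] :
    Nat.card {φ : A →ₐ[ZMod p] L // ∀ a, φ a ^ p ^ f = φ a} =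
      ∑ m : MaximalSpectrum A, (if Module.finrank (ZMod p) (A ⧸ m.asIdeal) ∣ f
        then Module.finrank (ZMod p) (A ⧸ m.asIdeal) else 0) := by
  classical
  let Θ : (Σ m : MaximalSpectrum A, {ψ : (A ⧸ m.asIdeal) →ₐ[ZMod p] L // ∀ a, ψ a ^ p ^ f = ψ a}) →
      {φ : A →ₐ[ZMod p] L // ∀ a, φ a ^ p ^ f = φ a} := fun x =>
    ⟨x.2.1.comp (Ideal.Quotient.mkₐ (ZMod p) x.1.asIdeal), fun a => x.2.2 _⟩
  have hker : ∀ x, RingHom.ker (Θ x).1 = x.1.asIdeal := by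
    rintro ⟨m, ψ, hψ⟩
    let := Ideal.Quotient.field m.asIdeal
    ext a
    simp only [Θ, RingHom.mem_ker, AlgHom.comp_apply]
    rw [map_eq_zero_iff ψ ψ.toRingHom.injective]
    simp [Ideal.Quotient.eq_zero_iff_mem]
  have hΘ : Function.Bijective Θ := by
    constructor
    · rintro x y hxy
      have h1 : x.1 = y.1 := by
        ext1
        rw [← hker x, ← hker y, hxy]
      obtain ⟨m, ψ, hψ⟩ := x
      obtain ⟨m', ψ', hψ'⟩ := y
      obtain rfl : m = m' := h1
      congr 2
      apply Ideal.Quotient.algHom_ext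
      exact congrArg Subtype.val hxy
    · rintro ⟨φ, hφ⟩
      have : (RingHom.ker φ).IsPrime := RingHom.ker_isPrime _
      have hm : (RingHom.ker φ).IsMaximal := inferInstance
      refine ⟨⟨⟨RingHom.ker φ, hm⟩, Ideal.Quotient.liftₐ _ φ (fun a ha => ha), ?_⟩, ?_⟩
      · intro a
        obtain ⟨a, rfl⟩ := Ideal.Quotient.mk_surjective a
        exact hφ a
      · apply Subtype.ext
        ext a
        rfl
  rw [← Nat.card_congr (Equiv.ofBijective Θ hΘ), Nat.card_sigma]
  refine Finset.sum_congr rfl fun m _ => ?_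
  let := Ideal.Quotient.field m.asIdeal
  have : Finite (A ⧸ m.asIdeal) := Finite.of_surjective _ Ideal.Quotient.mk_surjective
  exact aux_field p f (A ⧸ m.asIdeal) L

theorem aux_group (p f : ℕ) [Fact p.Prime] (G L : Type*) [CommGroup G] [Fintype G]
    (hG : ¬ p ∣ Fintype.card G) [Field L] [Algebra (ZMod p) L] [IsAlgClosed L] :
    Nat.card {φ : MonoidAlgebra (ZMod p) G →ₐ[ZMod p] L // ∀ a, φ a ^ p ^ f = φ a} =
      ∑ d ∈ (Fintype.card G).divisors,
        (if orderOf (p : ZMod d) ∣ f then Nat.card {x : G // orderOf x = d} else 0) := by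
  classical
  have hp : p.Prime := Fact.out
  have : CharP L p := charP_of_injective_algebraMap (algebraMap (ZMod p) L).injective p
  have hpf : 1 ≤ p ^ f := Nat.one_le_pow _ _ hp.pos
  have : NeZero ((Monoid.exponent G : ℕ) : L) := by
    constructor
    rw [Ne, CharP.cast_eq_zero_iff L p]
    intro h
    apply hG
    exact h.trans Group.exponent_dvd_card
  obtain ⟨E⟩ := CommGroup.monoidHom_mulEquiv_of_hasEnoughRootsOfUnity G L
  let e1 : (G →* Lˣ) ≃ (MonoidAlgebra (ZMod p) G →ₐ[ZMod p] L) :=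
    { toFun := fun χ => MonoidAlgebra.lift (ZMod p) L G ((Units.coeHom L).comp χ)
      invFun := fun φ => ((MonoidAlgebra.lift (ZMod p) L G).symm φ).toHomUnits
      left_inv := fun χ => by ext g; simp
      right_inv := fun φ => by ext g; simp }
  have h1 : ∀ χ : G →* Lˣ, (∀ a, e1 χ a ^ p ^ f = e1 χ a) ↔ χ ^ (p ^ f - 1) = 1 := by
    intro χ
    have h2 : (∀ a, e1 χ a ^ p ^ f = e1 χ a) ↔ ∀ g, χ g ^ p ^ f = χ g := by
      constructor
      · intro h g
        have := h (MonoidAlgebra.single g 1)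
        simp [e1] at this
        exact_mod_cast this
      · intro h
        have h3 : (FiniteField.frobeniusAlgHom (ZMod p) L ^ f).comp (e1 χ) = e1 χ := by
          ext g
          have := congrArg (Units.val) (h g)
          simpa [e1, -AlgHom.coe_pow, aux_frob] using this
        intro a
        have := DFunLike.congr_fun h3 a
        rwa [AlgHom.comp_apply, aux_frob] at this
    rw [h2, MonoidHom.ext_iff]
    refine forall_congr' fun g => ?_
    conv_lhs => rw [← Nat.sub_add_cancel hpf, pow_succ]
    simp
  have h4 : ∀ χ : G →* Lˣ, (∀ a, e1 χ a ^ p ^ f = e1 χ a) ↔ (E χ) ^ (p ^ f - 1) = 1 := by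
    intro χ
    rw [h1, ← map_pow, map_eq_one_iff E E.injective]
  rw [← Nat.card_congr (e1.subtypeEquiv (p := fun χ => (E χ) ^ (p ^ f - 1) = 1)
    (fun χ => (h4 χ).symm)),
    Nat.card_congr (E.toEquiv.subtypeEquiv (p := fun χ => (E χ) ^ (p ^ f - 1) = 1) (q := fun g => g ^ (p ^ f - 1) = 1) (fun χ => Iff.rfl))]
  rw [Nat.card_eq_fintype_card, Fintype.card_subtype]
  rw [Finset.card_eq_sum_card_fiberwise (f := fun x : G => orderOf x)
    (t := (Fintype.card G).divisors) (by
      intro x _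
      simpa using orderOf_dvd_card)]
  refine Finset.sum_congr rfl fun d hd => ?_
  have h5 : d ∣ p ^ f - 1 ↔ orderOf (p : ZMod d) ∣ f := by
    rw [orderOf_dvd_iff_pow_eq_one, ← ZMod.natCast_eq_zero_iff, Nat.cast_sub hpf, sub_eq_zero]
    simp
  simp only [← h5]
  rw [Finset.filter_filter, Nat.card_eq_fintype_card, Fintype.card_subtype]
  split_ifs with h
  · congr 1
    ext x
    simp only [Finset.mem_filter, Finset.mem_univ, true_and, and_iff_right_iff_imp]
    rintro rfl
    exact orderOf_dvd_iff_pow_eq_one.1 h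
  · rw [Finset.card_eq_zero, Finset.filter_eq_empty_iff]
    rintro x - ⟨hx, rfl⟩
    exact h (orderOf_dvd_iff_pow_eq_one.2 hx)

theorem aux_modp (p : ℕ) [Fact p.Prime] (G : Type*) [CommGroup G] [Fintype G]
    (hG : ¬ p ∣ Fintype.card G) (k : ℕ → Polynomial (ZMod p))
    (hdeg : ∀ d ∈ (Fintype.card G).divisors, (k d).natDegree = orderOf ((p : ZMod d)))
    (hirr : ∀ d ∈ (Fintype.card G).divisors, Irreducible (k d)) :
    Nonempty (MonoidAlgebra (ZMod p) G ≃+*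
        Π d : (Fintype.card G).divisors,
          Fin (Nat.card {x : G // orderOf x = (d : ℕ)} / orderOf ((p : ZMod (d : ℕ)))) →
            Polynomial (ZMod p) ⧸ Ideal.span {k (d : ℕ)}) := by
  classical
  have hp : p.Prime := Fact.out
  let A := MonoidAlgebra (ZMod p) G
  have eqv : A ≃ (G → ZMod p) := (MonoidAlgebra.coeffEquiv).trans Finsupp.equivFunOnFinite
  have : Finite A := Finite.of_equiv _ eqv.symm
  have : NeZero (Nat.card G : ZMod p) := by
    constructor
    rw [Ne, ZMod.natCast_eq_zero_iff, Nat.card_eq_fintype_card]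
    exact hG
  have : IsReduced A := inferInstanceAs (IsReduced (MonoidAlgebra (ZMod p) G))
  have : Finite (MaximalSpectrum A) := inferInstance
  let : Fintype (MaximalSpectrum A) := Fintype.ofFinite _
  have hcop : ∀ d ∈ (Fintype.card G).divisors, p.Coprime d := by
    intro d hd
    rw [hp.coprime_iff_not_dvd]
    exact fun h => hG (h.trans (Nat.dvd_of_mem_divisors hd))
  have hpos : ∀ d ∈ (Fintype.card G).divisors, 0 < orderOf (p : ZMod d) := fun d hd =>
    aux_pos p d (hcop d hd) (Nat.pos_of_mem_divisors hd).ne'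
  let N : (Fintype.card G).divisors → ℕ := fun d =>
    Nat.card {x : G // orderOf x = (d : ℕ)} / orderOf ((p : ZMod (d : ℕ)))
  let J := Σ d : (Fintype.card G).divisors, Fin (N d)
  obtain ⟨e, he⟩ := aux_count
    (fun m : MaximalSpectrum A => Module.finrank (ZMod p) (A ⧸ m.asIdeal))
    (fun j : J => orderOf (p : ZMod (j.1 : ℕ)))
    (fun m => by
      have : Finite (A ⧸ m.asIdeal) := Finite.of_surjective _ Ideal.Quotient.mk_surjective
      have := m.isMaximal
      exact Module.finrank_pos)
    (fun j => hpos _ j.1.2) (by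
      intro f _
      rw [← aux_homs p f A (AlgebraicClosure (ZMod p)), aux_group p f G _ hG,
        Fintype.sum_sigma, ← Finset.sum_coe_sort]
      refine Finset.sum_congr rfl fun d _ => ?_
      split_ifs with h
      · change _ = ∑ _x : Fin (N d), orderOf (p : ZMod (d : ℕ))
        rw [Finset.sum_const, Finset.card_univ, Fintype.card_fin, smul_eq_mul]
        exact (Nat.div_mul_cancel (aux_dvd p G d (Nat.pos_of_mem_divisors d.2).ne'
          (hcop _ d.2))).symm
      · simp)
  have hfe : ∀ m : MaximalSpectrum A, Nonempty
      ((A ⧸ m.asIdeal) ≃+* (Polynomial (ZMod p) ⧸ Ideal.span {k ((e m).1 : ℕ)})) := by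
    intro m
    have hm := he m
    generalize e m = j at hm
    have : Finite (A ⧸ m.asIdeal) := Finite.of_surjective _ Ideal.Quotient.mk_surjective
    have hmax := m.isMaximal
    let := Ideal.Quotient.field m.asIdeal
    have hk := hirr _ j.1.2
    have : Fact (Irreducible (k (j.1 : ℕ))) := ⟨hk⟩
    let : Fintype (A ⧸ m.asIdeal) := Fintype.ofFinite _
    let pb := AdjoinRoot.powerBasis hk.ne_zero
    have : Module.Finite (ZMod p) (AdjoinRoot (k (j.1 : ℕ))) := pb.finite
    have hfin : Finite (AdjoinRoot (k (j.1 : ℕ))) := Module.finite_of_finite (ZMod p)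
    let : Fintype (AdjoinRoot (k (j.1 : ℕ))) := Fintype.ofFinite _
    have h2 : Fintype.card (AdjoinRoot (k (j.1 : ℕ))) = p ^ orderOf (p : ZMod (j.1 : ℕ)) := by
      rw [Module.card_eq_pow_finrank (K := ZMod p), ZMod.card, pb.finrank,
        AdjoinRoot.powerBasis_dim, hdeg _ j.1.2]
    have h1 : Fintype.card (A ⧸ m.asIdeal) = p ^ orderOf (p : ZMod (j.1 : ℕ)) := by
      rw [Module.card_eq_pow_finrank (K := ZMod p), ZMod.card, hm]
    exact ⟨FiniteField.ringEquivOfCardEq (K := A ⧸ m.asIdeal) (K' := AdjoinRoot (k (j.1 : ℕ)))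
      (h1.trans h2.symm)⟩
  have E1 : A ≃+* (Π m : MaximalSpectrum A, A ⧸ m.asIdeal) := (IsArtinianRing.equivPi A).toRingEquiv
  have E2 : (Π m : MaximalSpectrum A, A ⧸ m.asIdeal) ≃+*
      (Π m : MaximalSpectrum A, (Polynomial (ZMod p) ⧸ Ideal.span {k ((e m).1 : ℕ)})) :=
    RingEquiv.piCongrRight fun m => (hfe m).some
  have E3 : (Π m : MaximalSpectrum A, (Polynomial (ZMod p) ⧸ Ideal.span {k ((e m).1 : ℕ)})) ≃+*
      (Π j : J, (Polynomial (ZMod p) ⧸ Ideal.span {k (j.1 : ℕ)})) :=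
    RingEquiv.piCongrLeft (fun j : J => Polynomial (ZMod p) ⧸ Ideal.span {k (j.1 : ℕ)}) e
  have E4 : (Π j : J, (Polynomial (ZMod p) ⧸ Ideal.span {k (j.1 : ℕ)})) ≃+*
      (Π d : (Fintype.card G).divisors, Fin (N d) →
            Polynomial (ZMod p) ⧸ Ideal.span {k (d : ℕ)}) :=
    { Equiv.piCurry (fun (d : (Fintype.card G).divisors) (_ : Fin (N d)) =>
        Polynomial (ZMod p) ⧸ Ideal.span {k (d : ℕ)}) with
      map_mul' := fun _ _ => rfl
      map_add' := fun _ _ => rfl }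
  exact ⟨((E1.trans E2).trans E3).trans E4⟩

/-- reduction mod `p` on `R[X]/(h)` -/
theorem aux_quot (p r : ℕ) [Fact p.Prime] (hr : 1 ≤ r) (h : Polynomial (ZMod (p ^ r))) :
    ∃ π : (Polynomial (ZMod (p ^ r)) ⧸ Ideal.span {h}) →+*
      (Polynomial (ZMod p) ⧸ Ideal.span {h.map
        (ZMod.castHom (dvd_pow_self p (Nat.one_le_iff_ne_zero.mp hr)) (ZMod p))}),
      Function.Surjective π ∧ ∀ b, π b = 0 → ((p : ℕ) : _ ⧸ Ideal.span {h}) ∣ b := by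
  have hdvd := dvd_pow_self p (Nat.one_le_iff_ne_zero.mp hr)
  set c : ZMod (p ^ r) →+* ZMod p := ZMod.castHom hdvd (ZMod p) with hc
  have hcs : Function.Surjective c := ZMod.ringHom_surjective c
  have hms := Polynomial.map_surjective c hcs
  let π : (Polynomial (ZMod (p ^ r)) ⧸ Ideal.span {h}) →+*
      (Polynomial (ZMod p) ⧸ Ideal.span {h.map c}) :=
    Ideal.quotientMap _ (Polynomial.mapRingHom c) (by
      rw [Ideal.span_singleton_le_iff_mem, Ideal.mem_comap]
      exact Ideal.subset_span rfl)
  refine ⟨π, ?_, ?_⟩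
  · intro y
    obtain ⟨y, rfl⟩ := Ideal.Quotient.mk_surjective y
    obtain ⟨x, rfl⟩ := hms y
    exact ⟨Ideal.Quotient.mk _ x, by simp [π]⟩
  · intro b hb
    obtain ⟨b, rfl⟩ := Ideal.Quotient.mk_surjective b
    simp only [π, Ideal.quotientMap_mk, Ideal.Quotient.eq_zero_iff_mem,
      Ideal.mem_span_singleton, Polynomial.coe_mapRingHom] at hb
    obtain ⟨g, hg⟩ := hb
    obtain ⟨g, rfl⟩ := hms g
    have h1 : (b - h * g).map c = 0 := by
      rw [Polynomial.map_sub, Polynomial.map_mul, hg, sub_self]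
    have h2 : Polynomial.C (p : ZMod (p ^ r)) ∣ b - h * g := by
      rw [Polynomial.C_dvd_iff_dvd_coeff]
      intro i
      have h3 : c ((b - h * g).coeff i) = 0 := by
        rw [← Polynomial.coeff_map, h1, Polynomial.coeff_zero]
      generalize (b - h * g).coeff i = z at h3
      have : NeZero (p ^ r) := ⟨pow_ne_zero _ (Fact.out : p.Prime).ne_zero⟩
      obtain ⟨n, rfl⟩ := ZMod.natCast_zmod_surjective z
      rw [map_natCast, ZMod.natCast_eq_zero_iff] at h3
      exact Nat.cast_dvd_cast h3
    obtain ⟨q, hq⟩ := h2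
    refine ⟨Ideal.Quotient.mk _ q, ?_⟩
    have h4 : b = h * g + Polynomial.C (p : ZMod (p ^ r)) * q := by rw [← hq]; ring
    have h5 : Ideal.Quotient.mk (Ideal.span {h}) h = 0 :=
      Ideal.Quotient.eq_zero_iff_mem.2 (Ideal.subset_span rfl)
    rw [h4, map_add, map_mul, h5, zero_mul, zero_add, map_mul]
    simp

theorem aux_card (R : Type*) [CommRing R] [Nontrivial R] [Finite R] (h : Polynomial R) (hm : h.Monic) :
    Finite (Polynomial R ⧸ Ideal.span {h}) ∧
    Nat.card (Polynomial R ⧸ Ideal.span {h}) = Nat.card R ^ h.natDegree := by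
  let pb := AdjoinRoot.powerBasis' hm
  have e := pb.basis.equivFun.toEquiv
  have hd : pb.dim = h.natDegree := AdjoinRoot.powerBasis'_dim hm
  refine ⟨Finite.of_equiv _ e.symm, (Nat.card_congr e).trans ?_⟩
  rw [Nat.card_fun, Nat.card_fin, hd]



/-- for a finite abelian group `G` of order `n` with `p ∤ n`,
the multiplicative order `o_d` of `p` mod `d` divides the number `n_d` of
elements of order `d` in `G`, for every divisor `d` of `n`; and for any family
of basic irreducible polynomials `h d` of degree `o_d` over `Z_{p^r}`,
`Z_{p^r} G ≅ ∏_{d ∣ n} ((Z_{p^r})[X]/⟨h d⟩)^{n_d / o_d}`. -/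
theorem zmod_pow_abelian_groupRing_decomposition (p r : ℕ) [Fact p.Prime] (hr : 1 ≤ r)
    (G : Type*) [CommGroup G] [Fintype G]
    (hG : ¬ p ∣ Fintype.card G) :
    (∀ d ∈ (Fintype.card G).divisors,
      orderOf ((p : ZMod d)) ∣ Nat.card {x : G // orderOf x = d}) ∧
    ∀ h : ℕ → Polynomial (ZMod (p ^ r)),
      (∀ d ∈ (Fintype.card G).divisors, (h d).Monic) →
      (∀ d ∈ (Fintype.card G).divisors, (h d).natDegree = orderOf ((p : ZMod d))) →
      (∀ d ∈ (Fintype.card G).divisors, Irreducible ((h d).map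
        (ZMod.castHom (dvd_pow_self p (Nat.one_le_iff_ne_zero.mp hr)) (ZMod p)))) →
      Nonempty (MonoidAlgebra (ZMod (p ^ r)) G ≃+*
        Π d : (Fintype.card G).divisors,
          Fin (Nat.card {x : G // orderOf x = (d : ℕ)} / orderOf ((p : ZMod (d : ℕ)))) →
            Polynomial (ZMod (p ^ r)) ⧸ Ideal.span {h (d : ℕ)}) := by
  classical
  have hp : p.Prime := Fact.out
  have hcop : ∀ d ∈ (Fintype.card G).divisors, p.Coprime d := by
    intro d hd
    rw [hp.coprime_iff_not_dvd]
    exact fun h => hG (h.trans (Nat.dvd_of_mem_divisors hd))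
  have hdvd : ∀ d ∈ (Fintype.card G).divisors,
      orderOf ((p : ZMod d)) ∣ Nat.card {x : G // orderOf x = d} := fun d hd =>
    aux_dvd p G d (Nat.pos_of_mem_divisors hd).ne' (hcop d hd)
  refine ⟨hdvd, ?_⟩
  intro h hmon hdeg hirr
  have : Fact (1 < p ^ r) := ⟨Nat.one_lt_pow (Nat.one_le_iff_ne_zero.mp hr) hp.one_lt⟩
  have : NeZero (p ^ r) := ⟨pow_ne_zero _ hp.ne_zero⟩
  obtain ⟨e⟩ := aux_modp p G hG (fun d => (h d).map
        (ZMod.castHom (dvd_pow_self p (Nat.one_le_iff_ne_zero.mp hr)) (ZMod p)))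
    (fun d hd => by rw [(hmon d hd).natDegree_map, hdeg d hd]) hirr
  choose π hπs hπk using fun d : (Fintype.card G).divisors => aux_quot p r hr (h d)
  have hfin : ∀ d : (Fintype.card G).divisors,
      Finite (Polynomial (ZMod (p ^ r)) ⧸ Ideal.span {h (d : ℕ)}) := fun d =>
    (aux_card _ _ (hmon d d.2)).1
  refine aux_lift p r hr G hG _ _ (RingHom.pi fun d => RingHom.pi fun i =>
    (π d).comp ((Pi.evalRingHom
      (fun _ => Polynomial (ZMod (p ^ r)) ⧸ Ideal.span {h (d : ℕ)}) i).comp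
        (Pi.evalRingHom (fun d : (Fintype.card G).divisors =>
          Fin (Nat.card {x : G // orderOf x = (d : ℕ)} / orderOf ((p : ZMod (d : ℕ)))) →
            Polynomial (ZMod (p ^ r)) ⧸ Ideal.span {h (d : ℕ)}) d))) ?_ ?_ e ?_
  · intro y
    choose s hs using fun d => hπs d
    exact ⟨fun d i => s d (y d i), by funext d i; exact hs d _⟩
  · intro b hb
    have hb' : ∀ d i, π d (b d i) = 0 := fun d i => congrFun (congrFun hb d) i
    choose q hq using fun d i => hπk d _ (hb' d i)
    exact ⟨fun d i => q d i, by funext d i; exact hq d i⟩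
  · rw [Nat.card_pi]
    have h1 : ∀ d : (Fintype.card G).divisors, Nat.card
        (Fin (Nat.card {x : G // orderOf x = (d : ℕ)} / orderOf ((p : ZMod (d : ℕ)))) →
            Polynomial (ZMod (p ^ r)) ⧸ Ideal.span {h (d : ℕ)}) =
        (p ^ r) ^ Nat.card {x : G // orderOf x = (d : ℕ)} := by
      intro d
      rw [Nat.card_fun, (aux_card _ _ (hmon d d.2)).2, Nat.card_zmod, Nat.card_fin, hdeg d d.2,
        ← pow_mul, Nat.mul_div_cancel' (hdvd d d.2)]
    rw [Finset.prod_congr rfl fun d _ => h1 d, Finset.prod_pow_eq_pow_sum]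
    congr 1
    rw [Finset.sum_coe_sort (Fintype.card G).divisors
      (fun d => Nat.card {x : G // orderOf x = d})]
    have h2 := Finset.card_eq_sum_card_fiberwise (s := (Finset.univ : Finset G))
      (f := fun x : G => orderOf x) (t := (Fintype.card G).divisors) (by
          intro x _
          simpa using orderOf_dvd_card)
    rw [Finset.card_univ] at h2
    refine Eq.trans ?_ h2.symm
    refine Finset.sum_congr rfl fun d _ => ?_
    rw [Nat.card_eq_fintype_card, Fintype.card_subtype]
end

section
/- Let r ≥ 2 be an integer and let C_5 = ⟨g⟩ be a cyclic group of order 5. In Z_{2^r}C_5, let a := 3 · 5⁻¹ (5 is a unit in Z_{2^r}), and consider the seven elements x₁ = 5, x₂ = −1, x₃ = 1 + g + g², x₄ = 1 + 2g, x₅ = 1 + 2g², x₆ = 1 + 4g, x₇ = (1 − a)(1 + g + g² + g³ + g⁴) − 1. Then each x_i is a unit of Z_{2^r}C_5; their orders in the unit group are respectively 2^{r−2}, 2, 15·2^{r−1}, 2^{r−1}, 2^{r−1}, 2^{r−2}, 2; and the unit group of Z_{2^r}C_5 is the internal direct product of the cyclic subgroups ⟨x₁⟩, …, ⟨x₇⟩: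 the map from the direct product ⟨x₁⟩ × ⟨x₂⟩ × ⟨x₃⟩ × ⟨x₄⟩ × ⟨x₅⟩ × ⟨x₆⟩ × ⟨x₇⟩ to the unit group of Z_{2^r}C_5 sending a tuple to the product of its entries is a group isomorphism. -/
/-- `v ∈ H` realises the class of `1 + 2^k y` modulo `2^(k+1)`. -/
def LevelMem {A : Type*} [CommRing A] (H : Subgroup Aˣ) (k : ℕ) (y : A) : Prop :=
  ∃ h ∈ H, ∃ z : A, (h : A) = 1 + 2 ^ k * y + 2 ^ (k + 1) * z

lemma LevelMem.congr {A : Type*} [CommRing A] {H : Subgroup Aˣ} {k : ℕ} {y : A}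
    (h : LevelMem H k y) (y' w : A) (e : y' = y + 2 * w) : LevelMem H k y' := by
  obtain ⟨v, hv, z, hz⟩ := h
  refine ⟨v, hv, z - w, ?_⟩
  rw [hz, e]; ring

lemma LevelMem.zero {A : Type*} [CommRing A] {H : Subgroup Aˣ} {k : ℕ} : LevelMem H k (0 : A) :=
  ⟨1, H.one_mem, 0, by simp⟩

lemma LevelMem.add {A : Type*} [CommRing A] {H : Subgroup Aˣ} {k : ℕ} (hk : 1 ≤ k) {y y' : A}
    (h : LevelMem H k y) (h' : LevelMem H k y') : LevelMem H k (y + y') := by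
  obtain ⟨v, hv, z, hz⟩ := h
  obtain ⟨v', hv', z', hz'⟩ := h'
  obtain ⟨m, rfl⟩ : ∃ m, k = m + 1 := ⟨k - 1, by omega⟩
  refine ⟨v * v', H.mul_mem hv hv', z + z' + 2 ^ m * (y + 2 * z) * (y' + 2 * z'), ?_⟩
  rw [Units.val_mul, hz, hz']; ring

lemma LevelMem.zsmul {A : Type*} [CommRing A] {H : Subgroup Aˣ} {k : ℕ} {y : A}
    (h : LevelMem H k y) (c : ℤ) : LevelMem H k ((c : A) * y) := by
  rcases Int.even_or_odd' c with ⟨d, rfl | rfl⟩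
  · exact LevelMem.zero.congr _ (d * y) (by push_cast; ring)
  · exact h.congr _ (d * y) (by push_cast; ring)

lemma LevelMem.succ {A : Type*} [CommRing A] {H : Subgroup Aˣ} {k : ℕ} (hk : 2 ≤ k) {y : A}
    (h : LevelMem H k y) : LevelMem H (k + 1) y := by
  obtain ⟨v, hv, z, hz⟩ := h
  obtain ⟨m, rfl⟩ : ∃ m, k = m + 2 := ⟨k - 2, by omega⟩
  refine ⟨v * v, H.mul_mem hv hv, z + 2 ^ m * (y + 2 * z) ^ 2, ?_⟩
  rw [Units.val_mul, hz]; ring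

/-- If both base levels are full, every unit congruent to `1` modulo `2` lies in `H`. -/
lemma mem_of_levels {A : Type*} [CommRing A] {H : Subgroup Aˣ} {r : ℕ} (hr : (2 : A) ^ r = 0)
    (h1 : ∀ y, LevelMem H 1 y) (h2 : ∀ y, LevelMem H 2 y) (v : Aˣ) (y : A)
    (hv : (v : A) = 1 + 2 * y) : v ∈ H := by
  have hlev : ∀ k, 1 ≤ k → ∀ y, LevelMem H k y := by
    intro k hk
    rcases hk.eq_or_lt with rfl | hk
    · exact h1
    · induction k, hk using Nat.le_induction with
      | base => exact h2
      | succ n hn ih => exact fun y => (ih (by omega) y).succ hn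
  have key : ∀ d k, 1 ≤ k → r ≤ k + d → ∀ (v : Aˣ) (y : A), (v : A) = 1 + 2 ^ k * y → v ∈ H := by
    intro d
    induction d with
    | zero =>
      intro k _ hd v y hv
      have : (2 : A) ^ k = 0 := pow_eq_zero_of_le (by omega) hr
      rw [this, zero_mul, add_zero] at hv
      have : v = 1 := Units.ext hv
      rw [this]; exact H.one_mem
    | succ d ih =>
      intro k hk hd v y hv
      obtain ⟨h, hh, z, hz⟩ := hlev k hk y
      have : v * h⁻¹ ∈ H := by
        refine ih (k + 1) (by omega) (by omega) _ (-z * (h⁻¹ : Aˣ)) ?_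
        rw [Units.val_mul]
        have e : (h : A) * (h⁻¹ : Aˣ) = 1 := by simp
        have e2 : (v : A) = h - 2 ^ (k + 1) * z := by rw [hz, hv]; ring
        rw [e2]; linear_combination e
      simpa using H.mul_mem this hh
  exact key r 1 le_rfl (by omega) v y (by rw [hv]; ring)

lemma pow_two_pow_of_four {A : Type*} [CommRing A] (x y : A) (hx : x = 1 + 4 * y) (m : ℕ) :
    ∃ z, x ^ 2 ^ m = 1 + 2 ^ (m + 2) * z := by
  induction m with
  | zero => exact ⟨y, by rw [hx]; ring⟩
  | succ m ih =>
    obtain ⟨z, hz⟩ := ih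
    refine ⟨z + 2 ^ (m + 1) * z ^ 2, ?_⟩
    rw [pow_succ 2 m, pow_mul, hz]; ring

lemma unit_pow_eq_one {A : Type*} [CommRing A] {r : ℕ} (hr2 : 2 ≤ r) (hr : (2 : A) ^ r = 0)
    (u : Aˣ) (n : ℕ) (y : A) (hu : (u : A) ^ n = 1 + 4 * y) : u ^ (n * 2 ^ (r - 2)) = 1 := by
  obtain ⟨z, hz⟩ := pow_two_pow_of_four _ y hu (r - 2)
  apply Units.ext
  rw [pow_mul, Units.val_pow_eq_pow_val, Units.val_pow_eq_pow_val, hz,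
    show r - 2 + 2 = r by omega, hr]
  simp

/-- The abstract properties of the ring `Z_{2^r}C_5` with generator `t`. -/
structure IsC5Ring (A : Type*) [CommRing A] (r : ℕ) (t : A) : Prop where
  ht : t ^ 5 = 1
  hr : (2 : A) ^ r = 0
  span : ∀ x : A, ∃ a b c d e : ℤ, x = a + b * t + c * t ^ 2 + d * t ^ 3 + e * t ^ 4
  indep : ∀ a b c d e : ℤ, (a + b * t + c * t ^ 2 + d * t ^ 3 + e * t ^ 4 : A) = 0 →
    (2 : ℤ) ^ r ∣ a ∧ (2 : ℤ) ^ r ∣ b ∧ (2 : ℤ) ^ r ∣ c ∧ (2 : ℤ) ^ r ∣ d ∧ (2 : ℤ) ^ r ∣ e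

namespace IsC5Ring

variable {A : Type*} [CommRing A] {r : ℕ} {t : A}

lemma isUnit (h : IsC5Ring A r t) (y : A) : IsUnit (1 + 2 * y) := by
  apply IsNilpotent.isUnit_one_add
  exact ⟨r, by rw [mul_pow, h.hr, zero_mul]⟩

/-- Coefficients of `(1 + t + t^2)^n` modulo `t^5 - 1`. -/
def cf : ℕ → ℤ × ℤ × ℤ × ℤ × ℤ
  | 0 => (1, 0, 0, 0, 0)
  | n + 1 =>
    let v := cf n
    (v.1 + v.2.2.2.1 + v.2.2.2.2, v.1 + v.2.1 + v.2.2.2.2, v.1 + v.2.1 + v.2.2.1,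
      v.2.1 + v.2.2.1 + v.2.2.2.1, v.2.2.1 + v.2.2.2.1 + v.2.2.2.2)

lemma pow_eq (h : IsC5Ring A r t) (n : ℕ) : (1 + t + t ^ 2) ^ n =
    ((cf n).1 : A) + (cf n).2.1 * t + (cf n).2.2.1 * t ^ 2 + (cf n).2.2.2.1 * t ^ 3
      + (cf n).2.2.2.2 * t ^ 4 := by
  induction n with
  | zero => simp [cf]
  | succ n ih =>
    rw [pow_succ, ih]
    simp only [cf]
    push_cast
    linear_combination ((cf n).2.2.2.1 + (cf n).2.2.2.2 + (cf n).2.2.2.2 * t : A) * h.ht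

lemma pow_fifteen (h : IsC5Ring A r t) : ∃ z : A,
    (1 + t + t ^ 2) ^ 15 = 1 + 2 * (1 + t + t ^ 4 + 2 * z) := by
  refine ⟨717581 + 717487 * t + 717335 * t ^ 2 + 717335 * t ^ 3 + 717487 * t ^ 4, ?_⟩
  rw [h.pow_eq 15, show cf 15 = (2870327, 2869950, 2869340, 2869340, 2869950) by decide]
  push_cast
  ring

lemma dvd_two (h : IsC5Ring A r t) (hr1 : 1 ≤ r) (a b c d e : ℤ) (y : A)
    (hy : (a + b * t + c * t ^ 2 + d * t ^ 3 + e * t ^ 4 : A) = 2 * y) :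
    2 ∣ a ∧ 2 ∣ b ∧ 2 ∣ c ∧ 2 ∣ d ∧ 2 ∣ e := by
  obtain ⟨a', b', c', d', e', rfl⟩ := h.span y
  have := h.indep (a - 2 * a') (b - 2 * b') (c - 2 * c') (d - 2 * d') (e - 2 * e')
    (by push_cast; linear_combination hy)
  have h2 : (2 : ℤ) ∣ 2 ^ r := dvd_pow_self 2 (by omega)
  obtain ⟨h1, h3, h4, h5, h6⟩ := this
  have := h2.trans h1
  have := h2.trans h3
  have := h2.trans h4
  have := h2.trans h5
  have := h2.trans h6
  omega

lemma cf_inj : ∀ i < 15, ∀ j < 15, (2 ∣ (cf i).1 - (cf j).1 ∧ 2 ∣ (cf i).2.1 - (cf j).2.1 ∧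
    2 ∣ (cf i).2.2.1 - (cf j).2.2.1 ∧ 2 ∣ (cf i).2.2.2.1 - (cf j).2.2.2.1 ∧
    2 ∣ (cf i).2.2.2.2 - (cf j).2.2.2.2) → i = j := by
  decide

lemma cf_surj : ∀ a : ℕ, a < 2 → ∀ b : ℕ, b < 2 → ∀ c : ℕ, c < 2 → ∀ d : ℕ, d < 2 → ∀ e : ℕ, e < 2 →
    (2 ∣ a + b + c + d + e) ∨ (a = 1 ∧ b = 1 ∧ c = 1 ∧ d = 1 ∧ e = 1) ∨
    ∃ i : ℕ, i < 15 ∧ (2 ∣ (a : ℤ) - (cf i).1 ∧ 2 ∣ (b : ℤ) - (cf i).2.1 ∧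
    2 ∣ (c : ℤ) - (cf i).2.2.1 ∧ 2 ∣ (d : ℤ) - (cf i).2.2.2.1 ∧
    2 ∣ (e : ℤ) - (cf i).2.2.2.2) := by
  intro a ha b hb c hc d hd e he
  interval_cases a <;> interval_cases b <;> interval_cases c <;> interval_cases d <;>
    interval_cases e <;> decide

lemma pow_inj (h : IsC5Ring A r t) (hr1 : 1 ≤ r) (i j : ℕ) (hi : i < 15) (hj : j < 15) (y : A)
    (hy : (1 + t + t ^ 2) ^ i - (1 + t + t ^ 2) ^ j = 2 * y) : i = j := by
  rw [h.pow_eq, h.pow_eq] at hy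
  apply cf_inj i hi j hj
  apply h.dvd_two hr1 _ _ _ _ _ y
  push_cast
  linear_combination hy

lemma unit_class (h : IsC5Ring A r t) (hr1 : 1 ≤ r) (x : A) (hx : IsUnit x) :
    ∃ i : ℕ, ∃ y : A, x = (1 + t + t ^ 2) ^ i + 2 * y := by
  obtain ⟨s, rfl⟩ : ∃ s, r = s + 1 := ⟨r - 1, by omega⟩
  have hann : ∀ z : A, x * z * 2 ^ s = 0 → z * 2 ^ s = 0 := by
    intro z hz
    rwa [mul_assoc, hx.mul_right_eq_zero] at hz
  have hnd : ¬ (2 : ℤ) ^ (s + 1) ∣ 2 ^ s := by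
    intro hd
    have := Int.le_of_dvd (by positivity) hd
    have h2 : (0 : ℤ) < 2 ^ s := by positivity
    rw [pow_succ] at this
    omega
  have hrs := h.hr
  have ht := h.ht
  obtain ⟨a, b, c, d, e, hxe⟩ := h.span x
  have hred : ∀ a : ℤ, ∃ a' : ℤ, ∃ α : ℕ, α < 2 ∧ a = α + 2 * a' := fun a =>
    ⟨a / 2, (a % 2).toNat, by omega, by omega⟩
  obtain ⟨a', α, hα, rfl⟩ := hred a
  obtain ⟨b', β, hβ, rfl⟩ := hred b
  obtain ⟨c', γ, hγ, rfl⟩ := hred c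
  obtain ⟨d', δ, hδ, rfl⟩ := hred d
  obtain ⟨e', ε, hε, rfl⟩ := hred e
  push_cast at hxe
  rcases cf_surj α hα β hβ γ hγ δ hδ ε hε with ⟨k, hk⟩ | ⟨rfl, rfl, rfl, rfl, rfl⟩ | ⟨i, -, hi⟩
  · exfalso
    have hk' : (α + β + γ + δ + ε : A) = 2 * k := by exact_mod_cast congrArg (Nat.cast : ℕ → A) hk
    have := hann (1 + t + t ^ 2 + t ^ 3 + t ^ 4) (by
      have e1 : t * (1 + t + t ^ 2 + t ^ 3 + t ^ 4) = 1 + t + t ^ 2 + t ^ 3 + t ^ 4 := by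
        linear_combination ht
      have e2 : x * (1 + t + t ^ 2 + t ^ 3 + t ^ 4) =
          2 * (k + a' + b' + c' + d' + e') * (1 + t + t ^ 2 + t ^ 3 + t ^ 4) := by
        generalize (1 + t + t ^ 2 + t ^ 3 + t ^ 4) = N at e1
        rw [hxe]
        linear_combination N * hk' + ((β + 2 * b') + (γ + 2 * c') * (1 + t) +
          (δ + 2 * d') * (1 + t + t ^ 2) + (ε + 2 * e') * (1 + t + t ^ 2 + t ^ 3)) * e1
      rw [e2]
      linear_combination (k + a' + b' + c' + d' + e') * (1 + t + t ^ 2 + t ^ 3 + t ^ 4) * hrs)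
    have := h.indep (2 ^ s) (2 ^ s) (2 ^ s) (2 ^ s) (2 ^ s) (by
      push_cast; linear_combination this)
    exact hnd this.1
  · exfalso
    have := hann (1 - t) (by
      rw [hxe]
      push_cast
      linear_combination - 2 ^ s * ht +
        (a' + b' * t + c' * t ^ 2 + d' * t ^ 3 + e' * t ^ 4) * (1 - t) * hrs)
    have := h.indep (2 ^ s) (- 2 ^ s) 0 0 0 (by push_cast; linear_combination this)
    exact hnd this.1
  · obtain ⟨⟨a1, h1⟩, ⟨a2, h2⟩, ⟨a3, h3⟩, ⟨a4, h4⟩, ⟨a5, h5⟩⟩ := hi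
    refine ⟨i, (a1 + a') + (a2 + b') * t + (a3 + c') * t ^ 2 + (a4 + d') * t ^ 3
      + (a5 + e') * t ^ 4, ?_⟩
    have h1 := congrArg (Int.cast : ℤ → A) h1
    have h2 := congrArg (Int.cast : ℤ → A) h2
    have h3 := congrArg (Int.cast : ℤ → A) h3
    have h4 := congrArg (Int.cast : ℤ → A) h4
    have h5 := congrArg (Int.cast : ℤ → A) h5
    push_cast at h1 h2 h3 h4 h5
    rw [h.pow_eq, hxe]
    linear_combination h1 + h2 * t + h3 * t ^ 2 + h4 * t ^ 3 + h5 * t ^ 4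

lemma level_all (h : IsC5Ring A r t) {H : Subgroup Aˣ} {k : ℕ} (hk : 1 ≤ k)
    (h0 : LevelMem H k (1 : A)) (h1 : LevelMem H k t) (h2 : LevelMem H k (t ^ 2))
    (h3 : LevelMem H k (t ^ 3)) (h4 : LevelMem H k (t ^ 4)) (y : A) : LevelMem H k y := by
  obtain ⟨a, b, c, d, e, rfl⟩ := h.span y
  have := h0.zsmul a
  rw [mul_one] at this
  exact ((((this.add hk (h1.zsmul b)).add hk (h2.zsmul c)).add hk (h3.zsmul d)).add hk
    (h4.zsmul e))

/-- The seven units generate everything. -/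
lemma gen (h : IsC5Ring A r t) (hr1 : 1 ≤ r) (H : Subgroup Aˣ) (u : Fin 7 → Aˣ) (f : A)
    (hf : 5 * f = 1) (hu : ∀ i, u i ∈ H) (u0 : (u 0 : A) = 5) (u1 : (u 1 : A) = -1)
    (u2 : (u 2 : A) = 1 + t + t ^ 2) (u3 : (u 3 : A) = 1 + 2 * t) (u4 : (u 4 : A) = 1 + 2 * t ^ 2)
    (u5 : (u 5 : A) = 1 + 4 * t)
    (u6 : (u 6 : A) = (1 - 3 * f) * (1 + t + t ^ 2 + t ^ 3 + t ^ 4) - 1) (v : Aˣ) : v ∈ H := by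
  obtain ⟨z, hz⟩ := h.pow_fifteen
  have ht := h.ht
  have L1 : ∀ y, LevelMem H 1 y := by
    have h0 : LevelMem H 1 (1 : A) := ⟨u 1, hu 1, -1, by rw [u1]; ring⟩
    have h1 : LevelMem H 1 t := ⟨u 3, hu 3, 0, by rw [u3]; ring⟩
    have h2 : LevelMem H 1 (t ^ 2) := ⟨u 4, hu 4, 0, by rw [u4]; ring⟩
    have h4' : LevelMem H 1 (1 + t + t ^ 4) :=
      ⟨u 2 ^ 15, H.pow_mem (hu 2) 15, z, by
        rw [Units.val_pow_eq_pow_val, u2, hz]; ring⟩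
    have h4 : LevelMem H 1 (t ^ 4) :=
      ((h4'.add le_rfl h0).add le_rfl h1).congr _ (-1 - t) (by ring)
    have h3' : LevelMem H 1 ((1 + t + t ^ 2 + t ^ 3 + t ^ 4) - 1) :=
      ⟨u 6, hu 6, -2 * f * (1 + t + t ^ 2 + t ^ 3 + t ^ 4), by
        rw [u6]
        linear_combination (1 + t + t ^ 2 + t ^ 3 + t ^ 4) * hf⟩
    have h3 : LevelMem H 1 (t ^ 3) :=
      (((h3'.add le_rfl h1).add le_rfl h2).add le_rfl h4).congr _ (-t - t ^ 2 - t ^ 4) (by ring)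
    exact h.level_all le_rfl h0 h1 h2 h3 h4
  have L2 : ∀ y, LevelMem H 2 y := by
    have hk : 1 ≤ 2 := by norm_num
    have h0 : LevelMem H 2 (1 : A) := ⟨u 0, hu 0, 0, by rw [u0]; norm_num⟩
    have h1 : LevelMem H 2 t := ⟨u 5, hu 5, 0, by rw [u5]; ring⟩
    have h2' : LevelMem H 2 (t + t ^ 2) := ⟨u 3 ^ 2, H.pow_mem (hu 3) 2, 0, by
      rw [Units.val_pow_eq_pow_val, u3]; ring⟩
    have h2 : LevelMem H 2 (t ^ 2) := (h2'.add hk h1).congr _ (-t) (by ring)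
    have h4' : LevelMem H 2 (t ^ 2 + t ^ 4) := ⟨u 4 ^ 2, H.pow_mem (hu 4) 2, 0, by
      rw [Units.val_pow_eq_pow_val, u4]; ring⟩
    have h4 : LevelMem H 2 (t ^ 4) := (h4'.add hk h2).congr _ (-t ^ 2) (by ring)
    have h3' : LevelMem H 2 ((1 + t + t ^ 4) + (1 + t + t ^ 4) ^ 2) :=
      ⟨u 2 ^ 30, H.pow_mem (hu 2) 30, z + 2 * (1 + t + t ^ 4) * z + 2 * z ^ 2, by
        rw [Units.val_pow_eq_pow_val, u2, show (30 : ℕ) = 15 * 2 from rfl, pow_mul, hz]; ring⟩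
    have h3 : LevelMem H 2 (t ^ 3) :=
      (((h3'.add hk h1).add hk h2).add hk h4).congr _
        (-1 - t ^ 4 - t ^ 2 - 2 * t - t ^ 4 - 1) (by
          linear_combination -(2 + t ^ 3) * ht)
    exact h.level_all hk h0 h1 h2 h3 h4
  obtain ⟨i, y, hy⟩ := h.unit_class hr1 v v.isUnit
  have : v * (u 2 ^ i)⁻¹ ∈ H := by
    apply mem_of_levels h.hr L1 L2 _ (y * ((u 2 ^ i)⁻¹ : Aˣ))
    have e : ((u 2 ^ i : Aˣ) : A) * ((u 2 ^ i)⁻¹ : Aˣ) = 1 := Units.mul_inv _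
    have e2 : (v : A) = (u 2 ^ i : Aˣ) + 2 * y := by
      rw [Units.val_pow_eq_pow_val, u2, hy]
    rw [Units.val_mul, e2]
    linear_combination e
  simpa using H.mul_mem this (H.pow_mem (hu 2) i)

lemma card_ge (h : IsC5Ring A r t) (hr1 : 1 ≤ r) [Finite A] (w : Aˣ)
    (hw : (w : A) = 1 + t + t ^ 2) : 15 * (2 ^ (r - 1)) ^ 5 ≤ Nat.card Aˣ := by
  obtain ⟨s, rfl⟩ : ∃ s, r = s + 1 := ⟨r - 1, by omega⟩
  rw [Nat.add_sub_cancel]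
  let F : Fin 15 × (Fin 5 → Fin (2 ^ s)) → Aˣ := fun p => w ^ (p.1 : ℕ) *
    (h.isUnit ((p.2 0 : ℕ) + (p.2 1 : ℕ) * t + (p.2 2 : ℕ) * t ^ 2 + (p.2 3 : ℕ) * t ^ 3
      + (p.2 4 : ℕ) * t ^ 4)).unit
  have hF : Function.Injective F := by
    rintro ⟨i, c⟩ ⟨j, d⟩ hij
    have hv := congrArg (Units.val) hij
    simp only [F, Units.val_mul, Units.val_pow_eq_pow_val, IsUnit.unit_spec, hw] at hv
    have hi : i = j := by
      apply Fin.ext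
      refine h.pow_inj hr1 i j i.2 j.2
        ((1 + t + t ^ 2) ^ (j : ℕ) * ((d 0 : ℕ) + (d 1 : ℕ) * t + (d 2 : ℕ) * t ^ 2 + (d 3 : ℕ) * t ^ 3 + (d 4 : ℕ) * t ^ 4)
          - (1 + t + t ^ 2) ^ (i : ℕ) * ((c 0 : ℕ) + (c 1 : ℕ) * t + (c 2 : ℕ) * t ^ 2 + (c 3 : ℕ) * t ^ 3 + (c 4 : ℕ) * t ^ 4)) ?_
      linear_combination hv
    subst hi
    have hU : IsUnit ((1 + t + t ^ 2) ^ (i : ℕ)) := by rw [← hw]; exact w.isUnit.pow _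
    have hv := hU.mul_left_cancel hv
    have := h.indep (2 * ((c 0 : ℕ) - (d 0 : ℕ))) (2 * ((c 1 : ℕ) - (d 1 : ℕ)))
      (2 * ((c 2 : ℕ) - (d 2 : ℕ))) (2 * ((c 3 : ℕ) - (d 3 : ℕ))) (2 * ((c 4 : ℕ) - (d 4 : ℕ)))
      (by push_cast; linear_combination hv)
    have key : ∀ x y : Fin (2 ^ s), (2 : ℤ) ^ (s + 1) ∣ 2 * ((x : ℕ) - (y : ℕ)) → x = y := by
      intro x y hxy
      rw [pow_succ, mul_comm] at hxy
      have hd := Int.dvd_of_mul_dvd_mul_left (by norm_num) hxy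
      have hx : ((x : ℕ) : ℤ) < 2 ^ s := by exact_mod_cast x.2
      have hy : ((y : ℕ) : ℤ) < 2 ^ s := by exact_mod_cast y.2
      have := Int.eq_zero_of_abs_lt_dvd hd (by rw [abs_lt]; omega)
      apply Fin.ext
      omega
    obtain ⟨k0, k1, k2, k3, k4⟩ := this
    congr 1
    funext m
    fin_cases m
    · exact key _ _ k0
    · exact key _ _ k1
    · exact key _ _ k2
    · exact key _ _ k3
    · exact key _ _ k4
  have := Nat.card_le_card_of_injective F hF
  simpa using this

end IsC5Ring
lemma IsC5Ring.main {A : Type*} [CommRing A] {r : ℕ} {t : A} [Finite A] (h : IsC5Ring A r t)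
    (hr : 2 ≤ r) (f : A) (hf : 5 * f = 1) :
    ∃ u : Fin 7 → Aˣ,
      ((u 0 : A) = 5 ∧ (u 1 : A) = -1 ∧ (u 2 : A) = 1 + t + t ^ 2 ∧
       (u 3 : A) = 1 + 2 * t ∧ (u 4 : A) = 1 + 2 * t ^ 2 ∧ (u 5 : A) = 1 + 4 * t ∧
       (u 6 : A) = (1 - 3 * f) * (1 + t + t ^ 2 + t ^ 3 + t ^ 4) - 1) ∧
      (orderOf (u 0) = 2 ^ (r - 2) ∧
       orderOf (u 1) = 2 ∧
       orderOf (u 2) = 15 * 2 ^ (r - 1) ∧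
       orderOf (u 3) = 2 ^ (r - 1) ∧
       orderOf (u 4) = 2 ^ (r - 1) ∧
       orderOf (u 5) = 2 ^ (r - 2) ∧
       orderOf (u 6) = 2) ∧
      ∃ e : (Π i : Fin 7, Subgroup.zpowers (u i)) ≃* Aˣ,
        ∀ t : Π i : Fin 7, Subgroup.zpowers (u i), e t = ∏ i : Fin 7, ((t i : Aˣ)) := by
  obtain ⟨z, hz⟩ := h.pow_fifteen
  have ht := h.ht
  have i0 : IsUnit (5 : A) := by convert h.isUnit 2 using 1; norm_num
  have i2 : IsUnit (1 + t + t ^ 2) := by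
    rw [← isUnit_pow_iff (n := 15) (by norm_num), hz]; exact h.isUnit _
  have i5 : IsUnit (1 + 4 * t) := by convert h.isUnit (2 * t) using 1; ring
  have hN : (1 + t + t ^ 2 + t ^ 3 + t ^ 4) ^ 2 = 5 * (1 + t + t ^ 2 + t ^ 3 + t ^ 4) := by
    linear_combination (4 + 3 * t + 2 * t ^ 2 + t ^ 3) * ht
  have e6 : ((1 - 3 * f) * (1 + t + t ^ 2 + t ^ 3 + t ^ 4) - 1) ^ 2 = 1 := by
    generalize (1 + t + t ^ 2 + t ^ 3 + t ^ 4) = N at hN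
    linear_combination (1 - 3 * f) ^ 2 * hN + (9 * f - 3) * N * hf
  have i6 : IsUnit ((1 - 3 * f) * (1 + t + t ^ 2 + t ^ 3 + t ^ 4) - 1) := by
    rw [← isUnit_pow_iff (n := 2) (by norm_num), e6]; exact isUnit_one
  obtain ⟨u, u0, u1, u2, u3, u4, u5, u6⟩ : ∃ u : Fin 7 → Aˣ,
      ((u 0 : A) = 5 ∧ (u 1 : A) = -1 ∧ (u 2 : A) = 1 + t + t ^ 2 ∧
       (u 3 : A) = 1 + 2 * t ∧ (u 4 : A) = 1 + 2 * t ^ 2 ∧ (u 5 : A) = 1 + 4 * t ∧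
       (u 6 : A) = (1 - 3 * f) * (1 + t + t ^ 2 + t ^ 3 + t ^ 4) - 1) :=
    ⟨![i0.unit, -1, i2.unit, (h.isUnit t).unit, (h.isUnit (t ^ 2)).unit, i5.unit, i6.unit],
      rfl, rfl, rfl, rfl, rfl, rfl, rfl⟩
  refine ⟨u, ⟨u0, u1, u2, u3, u4, u5, u6⟩, ?_⟩
  obtain ⟨s, rfl⟩ : ∃ s, r = s + 2 := ⟨r - 2, by omega⟩
  let n : Fin 7 → ℕ := ![2 ^ s, 2, 15 * 2 ^ (s + 1), 2 ^ (s + 1), 2 ^ (s + 1), 2 ^ s, 2]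
  have hpow : ∀ i, u i ^ n i = 1 := by
    intro i
    fin_cases i
    · have := unit_pow_eq_one hr h.hr (u 0) 1 1 (by rw [u0]; norm_num)
      rwa [one_mul] at this
    · apply Units.ext
      change ((u 1 ^ 2 : Aˣ) : A) = 1
      rw [Units.val_pow_eq_pow_val, u1]; norm_num
    · have := unit_pow_eq_one hr h.hr (u 2) 30 ((1 + t + t ^ 4 + 2 * z) + (1 + t + t ^ 4 + 2 * z) ^ 2)
        (by rw [u2, show (30 : ℕ) = 15 * 2 from rfl, pow_mul, hz]; ring)
      rw [show 30 * 2 ^ (s + 2 - 2) = 15 * 2 ^ (s + 1) by rw [Nat.add_sub_cancel]; ring] at this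
      exact this
    · have := unit_pow_eq_one hr h.hr (u 3) 2 (t + t ^ 2) (by rw [u3]; ring)
      rw [show 2 * 2 ^ (s + 2 - 2) = 2 ^ (s + 1) by rw [Nat.add_sub_cancel]; ring] at this
      exact this
    · have := unit_pow_eq_one hr h.hr (u 4) 2 (t ^ 2 + t ^ 4) (by rw [u4]; ring)
      rw [show 2 * 2 ^ (s + 2 - 2) = 2 ^ (s + 1) by rw [Nat.add_sub_cancel]; ring] at this
      exact this
    · have := unit_pow_eq_one hr h.hr (u 5) 1 t (by rw [u5]; ring)
      rwa [one_mul] at this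
    · apply Units.ext
      change ((u 6 ^ 2 : Aˣ) : A) = 1
      rw [Units.val_pow_eq_pow_val, u6, e6]
  have hnpos : ∀ i, 0 < n i := by
    intro i; fin_cases i <;> simp [n]
  let φ : (Π i : Fin 7, Subgroup.zpowers (u i)) →* Aˣ :=
    { toFun := fun t => ∏ i : Fin 7, ((t i : Aˣ))
      map_one' := by simp
      map_mul' := fun a b => by simp [Finset.prod_mul_distrib] }
  have hmem : ∀ i, u i ∈ φ.range := by
    intro i
    refine ⟨Pi.mulSingle i ⟨u i, Subgroup.mem_zpowers _⟩, ?_⟩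
    change ∏ j : Fin 7, ((Pi.mulSingle i (⟨u i, Subgroup.mem_zpowers _⟩ : Subgroup.zpowers (u i)) :
      Π i : Fin 7, Subgroup.zpowers (u i)) j : Aˣ) = _
    rw [Finset.prod_eq_single i]
    · simp
    · intro j _ hj
      rw [Pi.mulSingle_eq_of_ne hj]; rfl
    · simp
  have hsurj : Function.Surjective φ := fun v =>
    h.gen (by omega) φ.range u f hf hmem u0 u1 u2 u3 u4 u5 u6 v
  have hcardP : Nat.card (Π i : Fin 7, Subgroup.zpowers (u i)) = ∏ i, orderOf (u i) := by
    rw [Nat.card_pi]; simp [Nat.card_zpowers]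
  have hprodn : ∏ i, n i = 15 * (2 ^ (s + 2 - 1)) ^ 5 := by
    simp only [n, Fin.prod_univ_seven]
    change 2 ^ s * 2 * (15 * 2 ^ (s + 1)) * 2 ^ (s + 1) * 2 ^ (s + 1) * 2 ^ s * 2 =
      15 * (2 ^ (s + 1)) ^ 5
    ring
  have hge : ∏ i, n i ≤ Nat.card Aˣ := by
    rw [hprodn]; exact h.card_ge (by omega) (u 2) u2
  have hle : ∀ i, orderOf (u i) ≤ n i := fun i => orderOf_le_of_pow_eq_one (hnpos i) (hpow i)
  have hcle : Nat.card Aˣ ≤ ∏ i, orderOf (u i) := by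
    rw [← hcardP]; exact Nat.card_le_card_of_surjective φ hsurj
  have hord : ∀ i, orderOf (u i) = n i := by
    intro i
    by_contra hne
    have : ∏ i, orderOf (u i) < ∏ i, n i :=
      Finset.prod_lt_prod (fun i _ => orderOf_pos (u i)) (fun i _ => hle i)
        ⟨i, Finset.mem_univ _, lt_of_le_of_ne (hle i) hne⟩
    omega
  have hbij : Function.Bijective φ := by
    apply hsurj.bijective_of_nat_card_le
    rw [hcardP]
    exact (Finset.prod_le_prod' fun i _ => hle i).trans hge
  exact ⟨⟨hord 0, hord 1, hord 2, hord 3, hord 4, hord 5, hord 6⟩,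
    MulEquiv.ofBijective φ hbij, fun t => rfl⟩

lemma isC5Ring_monoidAlgebra (r : ℕ) (G : Type*) [CommGroup G] [Fintype G]
    (g : G) (hg : orderOf g = 5) (hcard : Fintype.card G = 5) :
    IsC5Ring (MonoidAlgebra (ZMod (2 ^ r)) G) r (MonoidAlgebra.of (ZMod (2 ^ r)) G g) := by
  classical
  have hsm : ∀ (k : ℕ) (a : ℤ), (a : MonoidAlgebra (ZMod (2 ^ r)) G) *
      MonoidAlgebra.of (ZMod (2 ^ r)) G g ^ k = MonoidAlgebra.single (g ^ k) (a : ZMod (2 ^ r)) := by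
    intro k a
    rw [← map_pow, ← zsmul_eq_mul, MonoidAlgebra.of_apply, MonoidAlgebra.smul_single,
      zsmul_eq_mul, mul_one]
  refine ⟨?_, ?_, ?_, ?_⟩
  · rw [← map_pow, ← hg, pow_orderOf_eq_one, map_one]
  · have : ((2 : ZMod (2 ^ r)) ^ r) = 0 := by exact_mod_cast ZMod.natCast_self (2 ^ r)
    have := congrArg (algebraMap (ZMod (2 ^ r)) (MonoidAlgebra (ZMod (2 ^ r)) G)) this
    rwa [map_pow, map_ofNat, map_zero] at this
  · intro x
    induction x using MonoidAlgebra.induction_linear with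
    | zero => exact ⟨0, 0, 0, 0, 0, by simp⟩
    | add x y hx hy =>
      obtain ⟨a, b, c, d, e, rfl⟩ := hx
      obtain ⟨a', b', c', d', e', rfl⟩ := hy
      exact ⟨a + a', b + b', c + c', d + d', e + e', by push_cast; ring⟩
    | single m c =>
      obtain ⟨c, rfl⟩ := ZMod.intCast_surjective c
      have hm : m ∈ Subgroup.zpowers g := by
        have : Subgroup.zpowers g = ⊤ := by
          apply Subgroup.eq_top_of_card_eq
          rw [Nat.card_zpowers, hg, Nat.card_eq_fintype_card, hcard]
        rw [this]; trivial
      rw [mem_zpowers_iff_mem_range_orderOf, hg] at hm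
      obtain ⟨k, hk, rfl⟩ := Finset.mem_image.1 hm
      rw [← hsm]
      have hk := Finset.mem_range.1 hk
      interval_cases k
      · exact ⟨c, 0, 0, 0, 0, by simp⟩
      · exact ⟨0, c, 0, 0, 0, by simp⟩
      · exact ⟨0, 0, c, 0, 0, by simp⟩
      · exact ⟨0, 0, 0, c, 0, by simp⟩
      · exact ⟨0, 0, 0, 0, c, by simp⟩
  · intro a b c d e h0
    have hne : ∀ i < 5, ∀ j < 5, i ≠ j → g ^ i ≠ g ^ j := by
      intro i hi j hj hij he
      exact hij (pow_injOn_Iio_orderOf (by simpa [hg] using hi) (by simpa [hg] using hj) he)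
    have e0 := hsm 0 a
    have e1 := hsm 1 b
    rw [pow_zero, mul_one] at e0
    rw [pow_one] at e1
    rw [e0, e1, hsm, hsm, hsm] at h0
    have hco : ∀ k : ℕ, _ := fun k =>
      congrArg (fun x : MonoidAlgebra (ZMod (2 ^ r)) G => x.coeff (g ^ k)) h0
    have hz : ∀ a : ℤ, (a : ZMod (2 ^ r)) = 0 → (2 : ℤ) ^ r ∣ a := by
      intro a ha
      have := (ZMod.intCast_zmod_eq_zero_iff_dvd a (2 ^ r)).1 ha
      exact_mod_cast this
    simp only [MonoidAlgebra.coeff_add, MonoidAlgebra.coeff_single, MonoidAlgebra.coeff_zero,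
      Finsupp.add_apply, Finsupp.single_apply, Finsupp.zero_apply] at hco
    refine ⟨hz _ ?_, hz _ ?_, hz _ ?_, hz _ ?_, hz _ ?_⟩
    · have := hco 0
      rwa [if_pos rfl, if_neg (hne 1 (by simp) 0 (by simp) (by simp)),
        if_neg (hne 2 (by simp) 0 (by simp) (by simp)), if_neg (hne 3 (by simp) 0 (by simp) (by simp)),
        if_neg (hne 4 (by simp) 0 (by simp) (by simp)), add_zero, add_zero, add_zero, add_zero] at this
    · have := hco 1
      rwa [if_neg (hne 0 (by simp) 1 (by simp) (by simp)), if_pos rfl,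
        if_neg (hne 2 (by simp) 1 (by simp) (by simp)), if_neg (hne 3 (by simp) 1 (by simp) (by simp)),
        if_neg (hne 4 (by simp) 1 (by simp) (by simp)), zero_add, add_zero, add_zero, add_zero] at this
    · have := hco 2
      rwa [if_neg (hne 0 (by simp) 2 (by simp) (by simp)),
        if_neg (hne 1 (by simp) 2 (by simp) (by simp)), if_pos rfl,
        if_neg (hne 3 (by simp) 2 (by simp) (by simp)),
        if_neg (hne 4 (by simp) 2 (by simp) (by simp)), zero_add, zero_add, add_zero, add_zero] at this
    · have := hco 3
      rwa [if_neg (hne 0 (by simp) 3 (by simp) (by simp)),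
        if_neg (hne 1 (by simp) 3 (by simp) (by simp)),
        if_neg (hne 2 (by simp) 3 (by simp) (by simp)), if_pos rfl,
        if_neg (hne 4 (by simp) 3 (by simp) (by simp)), zero_add, zero_add, zero_add, add_zero] at this
    · have := hco 4
      rwa [if_neg (hne 0 (by simp) 4 (by simp) (by simp)),
        if_neg (hne 1 (by simp) 4 (by simp) (by simp)),
        if_neg (hne 2 (by simp) 4 (by simp) (by simp)),
        if_neg (hne 3 (by simp) 4 (by simp) (by simp)), if_pos rfl,
        zero_add, zero_add, zero_add, zero_add] at this

/-- for `r ≥ 2` and `C_5 = ⟨g⟩`, with `a := 3·5⁻¹` in `Z_{2^r}`, the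
seven elements `5`, `-1`, `1+g+g²`, `1+2g`, `1+2g²`, `1+4g`,
`(1-a)(1+g+g²+g³+g⁴)-1` are units of `Z_{2^r}C_5` of respective orders
`2^(r-2)`, `2`, `15·2^(r-1)`, `2^(r-1)`, `2^(r-1)`, `2^(r-2)`, `2`, and the unit
group of `Z_{2^r}C_5` is the internal direct product of the cyclic subgroups
they generate. -/
theorem unitGroup_Z2rC5 (r : ℕ) (hr : 2 ≤ r) (G : Type*) [CommGroup G] [Fintype G]
    (g : G) (hg : orderOf g = 5) (hcard : Fintype.card G = 5) :
    IsUnit (5 : ZMod (2 ^ r)) ∧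
    ∃ u : Fin 7 → (MonoidAlgebra (ZMod (2 ^ r)) G)ˣ,
      ((u 0 : MonoidAlgebra (ZMod (2 ^ r)) G) = 5 ∧
       (u 1 : MonoidAlgebra (ZMod (2 ^ r)) G) = -1 ∧
       (u 2 : MonoidAlgebra (ZMod (2 ^ r)) G)
          = 1 + MonoidAlgebra.of (ZMod (2 ^ r)) G g
              + MonoidAlgebra.of (ZMod (2 ^ r)) G g ^ 2 ∧
       (u 3 : MonoidAlgebra (ZMod (2 ^ r)) G)
          = 1 + 2 * MonoidAlgebra.of (ZMod (2 ^ r)) G g ∧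
       (u 4 : MonoidAlgebra (ZMod (2 ^ r)) G)
          = 1 + 2 * MonoidAlgebra.of (ZMod (2 ^ r)) G g ^ 2 ∧
       (u 5 : MonoidAlgebra (ZMod (2 ^ r)) G)
          = 1 + 4 * MonoidAlgebra.of (ZMod (2 ^ r)) G g ∧
       (u 6 : MonoidAlgebra (ZMod (2 ^ r)) G)
          = (1 - algebraMap (ZMod (2 ^ r)) (MonoidAlgebra (ZMod (2 ^ r)) G)
                  (3 * (5 : ZMod (2 ^ r))⁻¹))
              * (1 + MonoidAlgebra.of (ZMod (2 ^ r)) G g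
                  + MonoidAlgebra.of (ZMod (2 ^ r)) G g ^ 2
                  + MonoidAlgebra.of (ZMod (2 ^ r)) G g ^ 3
                  + MonoidAlgebra.of (ZMod (2 ^ r)) G g ^ 4) - 1) ∧
      (orderOf (u 0) = 2 ^ (r - 2) ∧
       orderOf (u 1) = 2 ∧
       orderOf (u 2) = 15 * 2 ^ (r - 1) ∧
       orderOf (u 3) = 2 ^ (r - 1) ∧
       orderOf (u 4) = 2 ^ (r - 1) ∧
       orderOf (u 5) = 2 ^ (r - 2) ∧
       orderOf (u 6) = 2) ∧
      ∃ e : (Π i : Fin 7, Subgroup.zpowers (u i)) ≃* (MonoidAlgebra (ZMod (2 ^ r)) G)ˣ,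
        ∀ t : Π i : Fin 7, Subgroup.zpowers (u i),
          e t = ∏ i : Fin 7, ((t i : (MonoidAlgebra (ZMod (2 ^ r)) G)ˣ)) := by
  have h2r : ((2 : ZMod (2 ^ r)) ^ r) = 0 := by
    exact_mod_cast ZMod.natCast_self (2 ^ r)
  have h5 : IsUnit (5 : ZMod (2 ^ r)) := by
    have : IsUnit ((5 : ℕ) : ZMod (2 ^ r)) := by
      rw [ZMod.isUnit_iff_coprime]
      exact Nat.Coprime.pow_right _ (by norm_num)
    exact_mod_cast this
  refine ⟨h5, ?_⟩
  have h := isC5Ring_monoidAlgebra r G g hg hcard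
  have hfin : Finite (MonoidAlgebra (ZMod (2 ^ r)) G) := by
    have : NeZero (2 ^ r) := ⟨by positivity⟩
    have : Finite (ZMod (2 ^ r)) := Finite.of_fintype _
    have : Finite (G →₀ ZMod (2 ^ r)) := Finite.of_injective _ DFunLike.coe_injective
    exact Finite.of_equiv _ (MonoidAlgebra.coeffEquiv (R := ZMod (2 ^ r)) (M := G)).symm
  have hf : 5 * algebraMap (ZMod (2 ^ r)) (MonoidAlgebra (ZMod (2 ^ r)) G) (5⁻¹) = 1 := by
    have := congrArg (algebraMap (ZMod (2 ^ r)) (MonoidAlgebra (ZMod (2 ^ r)) G))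
      (ZMod.mul_inv_of_unit _ h5)
    rw [map_mul, map_one, map_ofNat] at this
    exact this
  have := h.main hr _ hf
  simp only [map_mul, map_ofNat]
  exact this
end
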